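/- Let N = (B,E,F) be a locally finite, K-dense causal net with X = B ∪ E, and let λ be a line of N. Define δ_λ on closed sets by δ_λ(A) = 1 if λ ∩ A ≠ ∅ and δ_λ(A) = 0 otherwise. Then δ_λ is a two-valued state on the lattice of closed sets: δ_λ(X) = 1, and for every family (A_i)_{i ∈ I} of pairwise orthogonal closed sets (A_i ⊆ A_j' for i ≠ j), λ meets the join (⋃_{i ∈ I} A_i)'' if and only if there is exactly one index i ∈ I with λ ∩ A_i ≠ ∅. -/

import Mathlib

/-- A causal net `N = (B, E, F)`: conditions `B` and events `E` are disjoint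
countable sets covering the carrier, `F ⊆ (B × E) ∪ (E × B)` is the flow
relation, every element is in `dom F ∪ ran F`, every condition has at most one
`F`-predecessor and at most one `F`-successor, and `F⁺` is irreflexive. -/
structure CausalNet (α : Type*) where
  B : Set α
  E : Set α
  F : α → α → Prop
  countable_B : B.Countable
  countable_E : E.Countable
  disjoint_BE : Disjoint B E
  cover : B ∪ E = Set.univ
  bipartite : ∀ x y, F x y → (x ∈ B ∧ y ∈ E) ∨ (x ∈ E ∧ y ∈ B)
  no_isolated : ∀ x, (∃ y, F x y) ∨ (∃ y, F y x)
  pred_subsingleton : ∀ b ∈ B, {e | F e b}.Subsingleton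
  succ_subsingleton : ∀ b ∈ B, {e | F b e}.Subsingleton
  acyclic : ∀ x, ¬ Relation.TransGen F x x

namespace CausalNet

variable {α : Type*} (N : CausalNet α)

/-- The causal order `⊑ = F*` (reflexive-transitive closure of `F`). -/
def le (x y : α) : Prop := Relation.ReflTransGen N.F x y

/-- `li = ⊑ ∪ ⊒`: causal relatedness. -/
def li (x y : α) : Prop := N.le x y ∨ N.le y x

/-- `co = (X × X) \ li`: concurrency (causal independence). -/
def co (x y : α) : Prop := ¬ N.li x y

/-- `A' = {x | ∀ y ∈ A, x co y}`, the orthocomplement of `A`. -/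
def prime (A : Set α) : Set α := {x | ∀ y ∈ A, N.co x y}

/-- `A` is closed iff `A = A''`. -/
def Closed (A : Set α) : Prop := A = N.prime (N.prime A)

/-- A line is a maximal clique of `li`. -/
def IsLine (l : Set α) : Prop :=
  l.Pairwise N.li ∧ ∀ m : Set α, m.Pairwise N.li → l ⊆ m → m = l

/-- A cut is a maximal clique of `co ∪ id`, i.e. a maximal antichain. -/
def IsCut (c : Set α) : Prop :=
  c.Pairwise N.co ∧ ∀ m : Set α, m.Pairwise N.co → c ⊆ m → m = c

/-- K-density: every cut meets every line. -/
def KDense : Prop :=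
  ∀ c l : Set α, N.IsCut c → N.IsLine l → (c ∩ l).Nonempty

/-- The interval `[x, y] = {z | x ⊑ z ⊑ y}`. -/
def interval (x y : α) : Set α := {z | N.le x z ∧ N.le z y}

/-- Local finiteness: intervals are finite and every element has finitely many
immediate `F`-predecessors and immediate `F`-successors. -/
def LocallyFinite : Prop :=
  (∀ x y, (N.interval x y).Finite) ∧
  (∀ x, {y | N.F y x}.Finite) ∧ (∀ x, {y | N.F x y}.Finite)

/-- A B-cut of a subset `S`: a maximal antichain of `(S, ⊑)` consisting only of
conditions. -/
def IsBCutOf (S τ : Set α) : Prop :=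
  τ ⊆ S ∧ τ ⊆ N.B ∧ τ.Pairwise N.co ∧
  ∀ m : Set α, m ⊆ S → m.Pairwise N.co → τ ⊆ m → m = τ

/-- Preconditions `•e` of an event. -/
def pre (e : α) : Set α := {b | N.F b e}

/-- Postconditions `e•` of an event. -/
def post (e : α) : Set α := {b | N.F e b}

/-- Causally closed sets (Definition of `CC(N)`). -/
def CausallyClosed (C : Set α) : Prop :=
  (∀ e ∈ N.E, N.pre e ⊆ C → e ∈ C) ∧
  (∀ e ∈ N.E, N.post e ⊆ C → e ∈ C) ∧
  (∀ e ∈ N.E, e ∈ C → N.pre e ∪ N.post e ⊆ C) ∧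
  (∀ x ∈ C, ∀ y ∈ C, N.li x y → N.interval x y ⊆ C)

end CausalNet

namespace CausalNet

variable {α : Type*} (N : CausalNet α)

theorem co_symm {x y : α} (h : N.co x y) : N.co y x := fun h' => h h'.symm

theorem prime_anti {S T : Set α} (h : S ⊆ T) : N.prime T ⊆ N.prime S :=
  fun _ hx y hy => hx y (h hy)

theorem subset_prime_prime (S : Set α) : S ⊆ N.prime (N.prime S) :=
  fun x hx _ hy => N.co_symm (hy x hx)

/-- The net with the flow relation reversed. -/
def reverse : CausalNet α where
  B := N.B
  E := N.E
  F := Function.swap N.F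
  countable_B := N.countable_B
  countable_E := N.countable_E
  disjoint_BE := N.disjoint_BE
  cover := N.cover
  bipartite x y h := by
    rcases N.bipartite y x h with h | h
    · exact Or.inr h.symm
    · exact Or.inl h.symm
  no_isolated x := (N.no_isolated x).symm
  pred_subsingleton := N.succ_subsingleton
  succ_subsingleton := N.pred_subsingleton
  acyclic x h := N.acyclic x (Relation.transGen_swap.1 h)

theorem reverse_le {x y : α} : N.reverse.le x y ↔ N.le y x :=
  Relation.reflTransGen_swap

theorem reverse_co : N.reverse.co = N.co := by
  ext x y
  simp only [co, li, reverse_le, or_comm]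

theorem reverse_prime (S : Set α) : N.reverse.prime S = N.prime S := by
  simp only [prime, reverse_co]

/-- Orthocomplements are order-convex. -/
theorem mem_prime_of_le_of_le {S : Set α} {x y z : α} (hx : x ∈ N.prime S)
    (hz : z ∈ N.prime S) (hxy : N.le x y) (hyz : N.le y z) : y ∈ N.prime S := by
  rintro s hs (h | h)
  · exact hx s hs (Or.inl (hxy.trans h))
  · exact hz s hs (Or.inr (h.trans hyz))

/-- If an orthocomplement contains an event, then it contains its preconditions. -/
theorem mem_prime_of_flow {S : Set α} {b e : α} (hb : b ∈ N.B) (h : N.F b e)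
    (he : e ∈ N.prime S) : b ∈ N.prime S := by
  have hbe : N.le b e := .single h
  rintro s hs (h' | h')
  · rcases Relation.ReflTransGen.cases_head h' with rfl | ⟨c, hc, hcs⟩
    · exact he b hs (Or.inr hbe)
    · obtain rfl : c = e := N.succ_subsingleton b hb hc h
      exact he s hs (Or.inl hcs)
  · exact he s hs (Or.inr (h'.trans hbe))

theorem mem_prime_or_exists_le {S τ : Set α} (hτS : τ ⊆ N.prime S)
    (hτ : ∀ x ∈ N.prime S, ∃ t ∈ τ, N.li x t) {x a : α} (hxa : N.le x a)
    (ha : a ∈ N.prime S) : x ∈ N.prime S ∨ ∃ t ∈ τ, N.le x t := by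
  induction hxa using Relation.ReflTransGen.head_induction_on with
  | refl => exact Or.inl ha
  | @head x y hxy _ ih =>
    have hle : N.le x y := .single hxy
    rcases ih with hy | ⟨t, ht, hyt⟩
    · rcases N.bipartite x y hxy with ⟨hx, -⟩ | ⟨-, hyB⟩
      · exact Or.inl (N.mem_prime_of_flow hx hxy hy)
      · obtain ⟨t, ht, hyt | hty⟩ := hτ y hy
        · exact Or.inr ⟨t, ht, hle.trans hyt⟩
        · rcases Relation.ReflTransGen.cases_tail hty with rfl | ⟨z, htz, hzy⟩
          · exact Or.inr ⟨_, ht, hle⟩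
          · obtain rfl : z = x := N.pred_subsingleton y hyB hzy hxy
            exact Or.inl (N.mem_prime_of_le_of_le (hτS ht) hy htz hle)
    · exact Or.inr ⟨t, ht, hle.trans hyt⟩

/-- A maximal antichain of an orthocomplement has the same orthocomplement as the whole set. -/
theorem prime_eq_prime_of_maximal {S τ : Set α} (hτS : τ ⊆ N.prime S)
    (hτ : ∀ x ∈ N.prime S, ∃ t ∈ τ, N.li x t) : N.prime τ = N.prime (N.prime S) := by
  refine Set.Subset.antisymm (fun x hx a ha hxa => ?_) (N.prime_anti hτS)
  have hxS : x ∉ N.prime S := fun h =>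
    let ⟨t, ht, hxt⟩ := hτ x h
    hx t ht hxt
  rcases hxa with h | h
  · rcases N.mem_prime_or_exists_le hτS hτ h ha with h | ⟨t, ht, hxt⟩
    · exact hxS h
    · exact hx t ht (Or.inl hxt)
  · rw [← reverse_prime] at hτS ha hxS
    have hτ' : ∀ x ∈ N.reverse.prime S, ∃ t ∈ τ, N.reverse.li x t := by
      simpa only [reverse_prime, li, reverse_le, or_comm] using hτ
    rcases N.reverse.mem_prime_or_exists_le hτS hτ' (N.reverse_le.2 h) ha with h | ⟨t, ht, hxt⟩
    · exact hxS h
    · exact hx t ht (Or.inr (N.reverse_le.1 hxt))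

theorem exists_maximal_antichain (S : Set α) :
    ∃ τ ⊆ S, τ.Pairwise N.co ∧ ∀ x ∈ S, ∃ t ∈ τ, N.li x t := by
  obtain ⟨τ, hτ⟩ := zorn_subset {τ : Set α | τ ⊆ S ∧ τ.Pairwise N.co} fun c hc hchain =>
    ⟨⋃₀ c, ⟨Set.sUnion_subset fun s hs => (hc hs).1,
      (Set.pairwise_sUnion hchain.directedOn).2 fun s hs => (hc hs).2⟩,
      fun _ => Set.subset_sUnion_of_mem⟩
  refine ⟨τ, hτ.prop.1, hτ.prop.2, fun x hx => ?_⟩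
  by_contra! h
  have hins : insert x τ ∈ {τ : Set α | τ ⊆ S ∧ τ.Pairwise N.co} :=
    ⟨Set.insert_subset hx hτ.prop.1,
      hτ.prop.2.insert fun t ht _ => ⟨h t ht, N.co_symm (h t ht)⟩⟩
  exact h x (hτ.le_of_ge hins (Set.subset_insert x τ) (Set.mem_insert x τ)) (Or.inl .refl)

theorem isCut_of_forall_exists_li {c : Set α} (hc : c.Pairwise N.co)
    (h : ∀ x, ∃ t ∈ c, N.li x t) : N.IsCut c := by
  refine ⟨hc, fun m hm hcm => Set.Subset.antisymm (fun x hx => ?_) hcm⟩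
  obtain ⟨t, ht, hxt⟩ := h x
  by_cases hne : x = t
  · exact hne ▸ ht
  · exact absurd hxt (hm hx (hcm ht) hne)

theorem IsLine.li {N : CausalNet α} {l : Set α} (hl : N.IsLine l) {x y : α} (hx : x ∈ l)
    (hy : y ∈ l) : N.li x y := by
  by_cases h : x = y
  · exact h ▸ Or.inl .refl
  · exact hl.1 hx hy h

theorem IsLine.nonempty {N : CausalNet α} (hK : N.KDense) {l : Set α} (hl : N.IsLine l) :
    l.Nonempty := by
  obtain ⟨c, -, hc, hmax⟩ := N.exists_maximal_antichain Set.univ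
  exact (hK c l (N.isCut_of_forall_exists_li hc fun x => hmax x trivial) hl).right

/-- In a K-dense net, a line meeting the join of orthogonal closed sets meets one of them. -/
theorem IsLine.exists_inter_nonempty {N : CausalNet α} (hK : N.KDense) {l : Set α}
    (hl : N.IsLine l) {ι : Type*} {A : ι → Set α} (hA : ∀ i, N.Closed (A i))
    (horth : Pairwise fun i j => A i ⊆ N.prime (A j))
    (h : (l ∩ N.prime (N.prime (⋃ i, A i))).Nonempty) : ∃ i, (l ∩ A i).Nonempty := by
  obtain ⟨z, hzl, hz⟩ := h
  choose τ hτA hτ hτmax using fun i => N.exists_maximal_antichain (A i)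
  have hprime : ∀ i, N.prime (τ i) = N.prime (A i) := fun i => by
    have hA' : N.prime (N.prime (A i)) = A i := (hA i).symm
    have := N.prime_eq_prime_of_maximal (S := N.prime (A i)) (τ := τ i)
    rw [hA'] at this
    exact this (hτA i) (hτmax i)
  obtain ⟨σ, hσA, hσ, hσmax⟩ := N.exists_maximal_antichain (N.prime (⋃ i, A i))
  have hcut : N.IsCut ((⋃ i, τ i) ∪ σ) := by
    refine N.isCut_of_forall_exists_li ?_ fun x => ?_
    · rintro x (hx | hx) y (hy | hy) hne
      · obtain ⟨i, hi⟩ := Set.mem_iUnion.1 hx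
        obtain ⟨j, hj⟩ := Set.mem_iUnion.1 hy
        by_cases hij : i = j
        · subst hij
          exact hτ i hi hj hne
        · exact horth hij (hτA i hi) y (hτA j hj)
      · exact N.co_symm (hσA hy x (Set.iUnion_mono hτA hx))
      · exact hσA hx y (Set.iUnion_mono hτA hy)
      · exact hσ hx hy hne
    · by_contra! hx
      have hxA : x ∈ N.prime (⋃ i, A i) := by
        intro y hy
        obtain ⟨i, hi⟩ := Set.mem_iUnion.1 hy
        have hxi : x ∈ N.prime (τ i) := fun t ht => hx t (Or.inl (Set.mem_iUnion.2 ⟨i, ht⟩))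
        rw [hprime] at hxi
        exact hxi y hi
      obtain ⟨t, ht, hxt⟩ := hσmax x hxA
      exact hx t (Or.inr ht) hxt
  obtain ⟨y, hy | hy, hyl⟩ := hK _ l hcut hl
  · obtain ⟨i, hi⟩ := Set.mem_iUnion.1 hy
    exact ⟨i, y, hyl, hτA i hi⟩
  · exact absurd (hl.li hzl hyl) (hz y (hσA hy))

end CausalNet

/-- In a locally finite, K-dense causal net, every line `λ` induces
a two-valued state `δ_λ` on the lattice of closed sets: `δ_λ(X) = 1`, and for
every pairwise orthogonal family of closed sets, `λ` meets the join `(⋃ A_i)''`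
iff there is exactly one index `i` with `λ ∩ A_i ≠ ∅`. -/
theorem line_two_valued_state {α : Type*} (N : CausalNet α)
    (hLF : N.LocallyFinite) (hK : N.KDense)
    (l : Set α) (hl : N.IsLine l) :
    (l ∩ (Set.univ : Set α)).Nonempty ∧
    ∀ {ι : Type*} (A : ι → Set α), (∀ i, N.Closed (A i)) →
      (Pairwise fun i j => A i ⊆ N.prime (A j)) →
      ((l ∩ N.prime (N.prime (⋃ i, A i))).Nonempty ↔
        ∃! i, (l ∩ A i).Nonempty) := by
  refine ⟨by simpa using hl.nonempty hK, fun A hA horth => ⟨fun h => ?_, ?_⟩⟩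
  · obtain ⟨i, hi⟩ := hl.exists_inter_nonempty hK hA horth h
    refine ⟨i, hi, fun j ⟨y, hyl, hy⟩ => ?_⟩
    obtain ⟨x, hxl, hx⟩ := hi
    by_contra hne
    exact horth hne hy x hx (hl.li hyl hxl)
  · rintro ⟨i, ⟨x, hxl, hx⟩, -⟩
    exact ⟨x, hxl, N.subset_prime_prime _ (Set.mem_iUnion.2 ⟨i, hx⟩)⟩
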